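/- Let n be prime, d ≥ 1, α > 1/2, 1 ≤ λ < 2α, and let γ_1,…,γ_d be positive reals. Fix s ∈ {1,…,d} and arbitrary integers z_j for j ∈ {1,…,d} \ {s}. Then (1/n) Σ_{z_s=0}^{n−1} θ_s(z_1,…,z_d)^{1/λ} ≤ (2/n) Σ over subsets u ⊆ {1,…,d} with s ∈ u of ( ∏_{j∈u} γ_j^{1/λ} ) μ_{α,λ}^{|u|}, where μ_{α,λ} = 2 ζ(2α/λ). -/

import Mathlib

/-- `r_α(h) = |h|^{2α}` for `h ≠ 0` and `r_α(0) = 1`. -/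
noncomputable def rAlpha (α : ℝ) (h : ℤ) : ℝ :=
  if h = 0 then 1 else |(h : ℝ)| ^ (2 * α)

/-- `θ_s(z) = ∑_{u ⊆ {1,…,d}, s ∈ u} (∏_{j∈u} γ_j)
  ∑_{h ∈ ℤ^d, h_j ≠ 0 ⟺ j ∈ u, ∑_{j∈u} h_j z_j ≡ 0 (mod n)} ∏_{j∈u} r_α(h_j)⁻¹`. -/
noncomputable def theta (n d : ℕ) (α : ℝ) (γ : Fin d → ℝ) (s : Fin d) (z : Fin d → ℤ) : ℝ :=
  ∑ u ∈ Finset.univ.powerset.filter (fun u => s ∈ u),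
    (∏ j ∈ u, γ j) *
      ∑' h : Fin d → ℤ,
        if (∀ j, (h j ≠ 0 ↔ j ∈ u)) ∧ (n : ℤ) ∣ ∑ j ∈ u, h j * z j then
          ∏ j ∈ u, (rAlpha α (h j))⁻¹
        else 0

/-- `μ_{α,λ} = 2 ζ(2α/λ)` (real part of the Riemann zeta function at the real point `2α/λ`). -/
noncomputable def muAL (α lam : ℝ) : ℝ := 2 * (riemannZeta ((2 * α / lam : ℝ) : ℂ)).re

open scoped ENNReal

/-- Subadditivity of `x ↦ x ^ p`, `0 < p ≤ 1`, over finite sums. -/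
theorem ENNReal.rpow_sum_le_sum_rpow {ι : Type*} (t : Finset ι) (f : ι → ℝ≥0∞) {p : ℝ}
    (hp : 0 < p) (hp1 : p ≤ 1) : (∑ i ∈ t, f i) ^ p ≤ ∑ i ∈ t, f i ^ p :=
  Finset.le_sum_of_subadditive (fun x : ℝ≥0∞ => x ^ p) (ENNReal.zero_rpow_of_pos hp).le
    (fun a b => ENNReal.rpow_add_le_add_rpow a b hp.le hp1) t f

/-- Subadditivity of `x ↦ x ^ p`, `0 < p ≤ 1`, over infinite sums. -/
theorem ENNReal.rpow_tsum_le_tsum_rpow {ι : Type*} (f : ι → ℝ≥0∞) {p : ℝ}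
    (hp : 0 < p) (hp1 : p ≤ 1) : (∑' i, f i) ^ p ≤ ∑' i, f i ^ p := by
  rw [← ENNReal.le_rpow_inv_iff hp, ENNReal.tsum_eq_iSup_sum]
  refine iSup_le fun t => ?_
  rw [ENNReal.le_rpow_inv_iff hp]
  exact (ENNReal.rpow_sum_le_sum_rpow t f hp hp1).trans (ENNReal.sum_le_tsum t)

/-- `ENNReal.ofReal` of a (possibly junk) sum is at most the sum of the `ENNReal.ofReal`s. -/
theorem ENNReal.ofReal_tsum_le {ι : Type*} (f : ι → ℝ) (hf : ∀ i, 0 ≤ f i) :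
    ENNReal.ofReal (∑' i, f i) ≤ ∑' i, ENNReal.ofReal (f i) := by
  by_cases h : Summable f
  · exact (ENNReal.ofReal_tsum_of_nonneg hf h).le
  · simp [tsum_eq_zero_of_not_summable h]

/-- A sum of products over a finite-dimensional lattice is the product of the sums. -/
theorem ENNReal.tsum_fin_pi_prod {κ : Type*} {d : ℕ} (g : Fin d → κ → ℝ≥0∞) :
    ∑' h : Fin d → κ, ∏ j, g j (h j) = ∏ j, ∑' k, g j k := by
  induction d with
  | zero => simp [tsum_fintype]
  | succ d ih =>
    rw [Fin.prod_univ_succ, ← ih, ← (Fin.consEquiv fun _ => κ).tsum_eq, ENNReal.tsum_prod',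
      ← ENNReal.tsum_mul_right]
    refine tsum_congr fun a => ?_
    rw [← ENNReal.tsum_mul_left]
    refine tsum_congr fun b => ?_
    simp [Fin.consEquiv, Fin.prod_univ_succ]

/-- The two-sided zeta series: `∑_{k ∈ ℤ} |k|^{-β} = 2 ζ(β)`, the term at `0` being `0`. -/
theorem hasSum_int_abs_rpow_neg {β : ℝ} (hβ : 1 < β) :
    HasSum (fun k : ℤ => |(k : ℝ)| ^ (-β)) (2 * (riemannZeta (β : ℂ)).re) := by
  have hs : Summable fun m : ℕ => (m : ℝ) ^ (-β) := Real.summable_nat_rpow.2 (by linarith)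
  have hz : riemannZeta (β : ℂ) = ((∑' m : ℕ, (m : ℝ) ^ (-β) : ℝ) : ℂ) := by
    rw [zeta_eq_tsum_one_div_nat_cpow (by simpa using hβ), Complex.ofReal_tsum]
    refine tsum_congr fun m => ?_
    rw [Complex.ofReal_cpow (Nat.cast_nonneg m), Complex.ofReal_neg, Complex.cpow_neg, one_div,
      Complex.ofReal_natCast]
  rw [hz, Complex.ofReal_re]
  have h0 : (0 : ℝ) ^ (-β) = 0 := Real.zero_rpow (by linarith)
  have := HasSum.of_nat_of_neg (f := fun k : ℤ => |(k : ℝ)| ^ (-β))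
    (by simpa using hs.hasSum) (by simpa using hs.hasSum)
  simpa [h0, two_mul] using this

theorem muAL_nonneg {α lam : ℝ} (h : 1 < 2 * α / lam) : 0 ≤ muAL α lam :=
  (hasSum_int_abs_rpow_neg h).nonneg fun _ => by positivity

theorem tsum_ofReal_abs_rpow {α lam : ℝ} (h : 1 < 2 * α / lam) :
    ∑' k : ℤ, ENNReal.ofReal (|(k : ℝ)| ^ (-(2 * α / lam))) = ENNReal.ofReal (muAL α lam) := by
  have hs := hasSum_int_abs_rpow_neg h
  rw [muAL, ← hs.tsum_eq]
  exact (ENNReal.ofReal_tsum_of_nonneg (fun _ => by positivity) hs.summable).symm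

/-- Multiples of `n` contribute at most a `1/n` fraction of `∑ |k|^{-β}`, so weighting them by `n`
at most doubles the sum. -/
theorem tsum_weighted_abs_rpow_le {n : ℕ} (hn : 0 < n) {β : ℝ} (hβ : 1 < β) :
    ∑' k : ℤ, (1 + if (n : ℤ) ∣ k then (n : ℝ≥0∞) else 0) * ENNReal.ofReal (|(k : ℝ)| ^ (-β)) ≤
      2 * ∑' k : ℤ, ENNReal.ofReal (|(k : ℝ)| ^ (-β)) := by
  simp only [add_mul, one_mul, ENNReal.tsum_add]
  rw [two_mul]
  refine add_le_add_right ?_ _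
  have hinj : Function.Injective fun m : ℤ => (n : ℤ) * m :=
    mul_right_injective₀ (by exact_mod_cast hn.ne')
  rw [← hinj.tsum_eq]
  · refine ENNReal.tsum_le_tsum fun m => ?_
    have hn0 : (0 : ℝ) < n := by exact_mod_cast hn
    have hn1 : (1 : ℝ) ≤ n := by exact_mod_cast hn
    simp only [dvd_mul_right, if_true]
    rw [← ENNReal.ofReal_natCast, ← ENNReal.ofReal_mul (by positivity)]
    refine ENNReal.ofReal_le_ofReal ?_
    push_cast
    rw [abs_mul, abs_of_pos hn0, Real.mul_rpow hn0.le (abs_nonneg _), ← mul_assoc]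
    refine mul_le_of_le_one_left (by positivity) ?_
    calc (n : ℝ) * (n : ℝ) ^ (-β) = (n : ℝ) ^ (1 + -β) := by
          rw [Real.rpow_add hn0, Real.rpow_one]
      _ ≤ 1 := Real.rpow_le_one_of_one_le_of_nonpos hn1 (by linarith)
  · intro k hk
    by_cases hd : (n : ℤ) ∣ k
    · obtain ⟨m, rfl⟩ := hd
      exact ⟨m, rfl⟩
    · simp [hd] at hk

/-- For prime `n`, the congruence `k x + c ≡ 0 (mod n)` has at most one solution `x` in
`{0, …, n-1}`, unless `n ∣ k`, when it has at most `n`. -/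
theorem card_linear_congruence_le {n : ℕ} (hn : n.Prime) (k c : ℤ) :
    (((Finset.range n).filter fun x : ℕ => (n : ℤ) ∣ k * (x : ℤ) + c).card : ℝ≥0∞) ≤
      1 + if (n : ℤ) ∣ k then (n : ℝ≥0∞) else 0 := by
  split_ifs with hk
  · refine le_add_left ?_
    exact_mod_cast (Finset.card_filter_le _ _).trans (Finset.card_range n).le
  · rw [add_zero]
    have : ((Finset.range n).filter fun x : ℕ => (n : ℤ) ∣ k * (x : ℤ) + c).card ≤ 1 := by
      refine Finset.card_le_one.2 fun x hx y hy => ?_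
      simp only [Finset.mem_filter, Finset.mem_range] at hx hy
      have h : (n : ℤ) ∣ k * ((x : ℤ) - y) := by
        have := dvd_sub hx.2 hy.2
        ring_nf at this ⊢
        exact this
      have h2 : (n : ℤ) ∣ (x : ℤ) - y :=
        ((Nat.prime_iff_prime_int.1 hn).dvd_or_dvd h).resolve_left hk
      have h3 : (x : ℤ) - y = 0 :=
        Int.eq_zero_of_abs_lt_dvd h2 (abs_lt.2 ⟨by omega, by omega⟩)
      omega
    exact_mod_cast this

/-- The sum over lattice points with support exactly `u` of `∏_{j ∈ u} |h_j|^{-β}`, with the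
`s`-coordinate weighted by `w`, factors. -/
theorem tsum_support_prod {d : ℕ} {s : Fin d} {u : Finset (Fin d)} (hs : s ∈ u)
    (w : ℤ → ℝ≥0∞) {f : ℤ → ℝ≥0∞} (hf : f 0 = 0) :
    ∑' h : Fin d → ℤ, (if ∀ j, (h j ≠ 0 ↔ j ∈ u) then w (h s) * ∏ j ∈ u, f (h j) else 0) =
      (∑' k, w k * f k) * (∑' k, f k) ^ (u.card - 1) := by
  set g : Fin d → ℤ → ℝ≥0∞ := fun j k =>
    if j ∈ u then (if j = s then w k else 1) * f k else if k = 0 then 1 else 0 with hg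
  have hterm : ∀ h : Fin d → ℤ,
      (if ∀ j, (h j ≠ 0 ↔ j ∈ u) then w (h s) * ∏ j ∈ u, f (h j) else 0) = ∏ j, g j (h j) := by
    intro h
    split_ifs with hh
    · rw [← Finset.prod_subset (Finset.subset_univ u)]
      · have : ∀ j ∈ u, g j (h j) = (if j = s then w (h j) else 1) * f (h j) := by
          intro j hj
          simp [hg, hj]
        rw [Finset.prod_congr rfl this, Finset.prod_mul_distrib, Finset.prod_ite_eq' u s]
        simp [hs]
      · intro j _ hj
        have : h j = 0 := not_not.1 fun h0 => hj ((hh j).1 h0)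
        simp [hg, hj, this]
    · push Not at hh
      obtain ⟨j, hj⟩ := hh
      refine (Finset.prod_eq_zero (Finset.mem_univ j) ?_).symm
      by_cases hju : j ∈ u
      · have : h j = 0 := by tauto
        simp [hg, hju, this, hf]
      · have : h j ≠ 0 := by tauto
        simp [hg, hju, this]
  simp only [hterm]
  rw [ENNReal.tsum_fin_pi_prod, ← Finset.prod_subset (Finset.subset_univ u)]
  · rw [← Finset.mul_prod_erase u _ hs, ← Finset.card_erase_of_mem hs]
    congr 1
    · simp [hg, hs]
    · refine Finset.prod_eq_pow_card fun j hj => ?_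
      obtain ⟨h1, h2⟩ := Finset.mem_erase.1 hj
      simp [hg, h1, h2]
  · intro j _ hj
    simp [hg, hj, tsum_ite_eq]

/-- The summand of `theta` for `u` and `h`, raised to the power `1 / λ`. -/
theorem ofReal_theta_term_rpow {d : ℕ} {α lam : ℝ} (hlam : 0 < lam) {u : Finset (Fin d)}
    {h : Fin d → ℤ} (hh : ∀ j, (h j ≠ 0 ↔ j ∈ u)) :
    ENNReal.ofReal (∏ j ∈ u, (rAlpha α (h j))⁻¹) ^ (1 / lam) =
      ∏ j ∈ u, ENNReal.ofReal (|(h j : ℝ)| ^ (-(2 * α / lam))) := by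
  have hr : ∀ j ∈ u, (rAlpha α (h j))⁻¹ = |(h j : ℝ)| ^ (-(2 * α)) := by
    intro j hj
    rw [rAlpha, if_neg ((hh j).2 hj), Real.rpow_neg (abs_nonneg _)]
  rw [Finset.prod_congr rfl hr, ENNReal.ofReal_prod_of_nonneg fun _ _ => by positivity,
    ← ENNReal.prod_rpow_of_nonneg (by positivity)]
  refine Finset.prod_congr rfl fun j _ => ?_
  rw [ENNReal.ofReal_rpow_of_nonneg (by positivity) (by positivity),
    ← Real.rpow_mul (abs_nonneg _)]
  congr 2
  ring

theorem rAlpha_pos (α : ℝ) (h : ℤ) : 0 < rAlpha α h := by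
  unfold rAlpha
  split_ifs with h0
  · exact one_pos
  · have : (h : ℝ) ≠ 0 := by exact_mod_cast h0
    positivity

theorem theta_nonneg (n d : ℕ) (α : ℝ) {γ : Fin d → ℝ} (hγ : ∀ j, 0 < γ j) (s : Fin d)
    (z : Fin d → ℤ) : 0 ≤ theta n d α γ s z := by
  refine Finset.sum_nonneg fun u _ => mul_nonneg (Finset.prod_nonneg fun j _ => (hγ j).le) ?_
  refine tsum_nonneg fun h => ?_
  split_ifs
  · exact Finset.prod_nonneg fun j _ => (inv_pos.2 (rAlpha_pos α _)).le
  · exact le_rfl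

/-- Jensen's inequality `(∑ a)^{1/λ} ≤ ∑ a^{1/λ}` applied to `theta`. -/
theorem ofReal_theta_rpow_le (n d : ℕ) (α : ℝ) {lam : ℝ} (hlam : 1 ≤ lam) {γ : Fin d → ℝ}
    (hγ : ∀ j, 0 < γ j) (s : Fin d) (z : Fin d → ℤ) :
    ENNReal.ofReal (theta n d α γ s z ^ (1 / lam)) ≤
      ∑ u ∈ Finset.univ.powerset.filter (fun u => s ∈ u),
        ENNReal.ofReal (∏ j ∈ u, γ j ^ (1 / lam)) *
          ∑' h : Fin d → ℤ,
            if (∀ j, (h j ≠ 0 ↔ j ∈ u)) ∧ (n : ℤ) ∣ ∑ j ∈ u, h j * z j then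
              ∏ j ∈ u, ENNReal.ofReal (|(h j : ℝ)| ^ (-(2 * α / lam)))
            else 0 := by
  have hl : 0 < lam := by linarith
  have hp : 0 < 1 / lam := by positivity
  have hp1 : 1 / lam ≤ 1 := (div_le_one hl).2 hlam
  have hT : ∀ (u : Finset (Fin d)) (h : Fin d → ℤ), (0 : ℝ) ≤
      if (∀ j, (h j ≠ 0 ↔ j ∈ u)) ∧ (n : ℤ) ∣ ∑ j ∈ u, h j * z j then
        ∏ j ∈ u, (rAlpha α (h j))⁻¹ else 0 := by
    intro u h
    split_ifs
    · exact Finset.prod_nonneg fun j _ => (inv_pos.2 (rAlpha_pos α _)).le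
    · exact le_rfl
  have hG : ∀ u : Finset (Fin d), 0 ≤ ∏ j ∈ u, γ j :=
    fun u => Finset.prod_nonneg fun j _ => (hγ j).le
  rw [← ENNReal.ofReal_rpow_of_nonneg (theta_nonneg n d α hγ s z) hp.le, theta,
    ENNReal.ofReal_sum_of_nonneg fun u _ => mul_nonneg (hG u) (tsum_nonneg (hT u))]
  refine (ENNReal.rpow_sum_le_sum_rpow _ _ hp hp1).trans (Finset.sum_le_sum fun u _ => ?_)
  rw [ENNReal.ofReal_mul (hG u), ENNReal.mul_rpow_of_nonneg _ _ hp.le,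
    ENNReal.ofReal_rpow_of_nonneg (hG u) hp.le, Real.finsetProd_rpow _ _ fun j _ => (hγ j).le]
  gcongr
  refine (ENNReal.rpow_le_rpow (ENNReal.ofReal_tsum_le _ (hT u)) hp.le).trans
    ((ENNReal.rpow_tsum_le_tsum_rpow _ hp hp1).trans (ENNReal.tsum_le_tsum fun h => ?_))
  split_ifs with hh
  · exact (ofReal_theta_term_rpow hl hh.1).le
  · rw [ENNReal.ofReal_zero, ENNReal.zero_rpow_of_pos hp]

/-- Summing over the free coordinate `z_s` the contribution of a fixed support `u`. -/
theorem sum_tsum_support_le {n : ℕ} (hn : n.Prime) {d : ℕ} {s : Fin d} {u : Finset (Fin d)}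
    (hs : s ∈ u) (z : Fin d → ℤ) {β : ℝ} (hβ : 1 < β) :
    (∑ zs ∈ Finset.range n, ∑' h : Fin d → ℤ,
      if (∀ j, (h j ≠ 0 ↔ j ∈ u)) ∧
          (n : ℤ) ∣ ∑ j ∈ u, h j * Function.update z s (zs : ℤ) j then
        ∏ j ∈ u, ENNReal.ofReal (|(h j : ℝ)| ^ (-β))
      else 0) ≤ 2 * (∑' k : ℤ, ENNReal.ofReal (|(k : ℝ)| ^ (-β))) ^ u.card := by
  rw [← Summable.tsum_finsetSum fun _ _ => ENNReal.summable]
  set w : ℤ → ℝ≥0∞ := fun k => 1 + if (n : ℤ) ∣ k then (n : ℝ≥0∞) else 0 with hw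
  set f : ℤ → ℝ≥0∞ := fun k => ENNReal.ofReal (|(k : ℝ)| ^ (-β)) with hf
  have hf0 : f 0 = 0 := by
    have : (0 : ℝ) ^ (-β) = 0 := Real.zero_rpow (by linarith)
    simp [hf, this]
  calc _ ≤ ∑' h : Fin d → ℤ,
        (if ∀ j, (h j ≠ 0 ↔ j ∈ u) then w (h s) * ∏ j ∈ u, f (h j) else 0) := by
        refine ENNReal.tsum_le_tsum fun h => ?_
        by_cases hh : ∀ j, (h j ≠ 0 ↔ j ∈ u)
        · have hsum : ∀ x : ℕ, ∑ j ∈ u, h j * Function.update z s (x : ℤ) j =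
              h s * (x : ℤ) + ∑ j ∈ u.erase s, h j * z j := by
            intro x
            rw [← Finset.add_sum_erase u _ hs, Function.update_self]
            congr 1
            refine Finset.sum_congr rfl fun j hj => ?_
            rw [Function.update_of_ne (Finset.ne_of_mem_erase hj)]
          simp only [hsum, hh, implies_true, true_and, if_true]
          rw [← Finset.sum_filter, Finset.sum_const, nsmul_eq_mul]
          gcongr
          exact card_linear_congruence_le hn _ _
        · simp [hh]
    _ = (∑' k, w k * f k) * (∑' k, f k) ^ (u.card - 1) := tsum_support_prod hs w hf0
    _ ≤ (2 * ∑' k, f k) * (∑' k, f k) ^ (u.card - 1) := by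
        gcongr
        exact tsum_weighted_abs_rpow_le hn.pos hβ
    _ = 2 * (∑' k, f k) ^ u.card := by
        rw [mul_assoc, ← pow_succ', Nat.sub_add_cancel (Finset.card_pos.2 ⟨s, hs⟩)]

/-- Averaging bound for the auxiliary target function: for prime `n`, `1 ≤ λ < 2α`, positive
weights `γ`, a coordinate `s` and arbitrary fixed integers `z_j` (`j ≠ s`),
`(1/n) ∑_{z_s=0}^{n−1} θ_s(z)^{1/λ} ≤ (2/n) ∑_{u ∋ s} (∏_{j∈u} γ_j^{1/λ}) μ_{α,λ}^{|u|}`. -/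
theorem theta_average_bound (n : ℕ) (hn : n.Prime) (d : ℕ) (hd : 1 ≤ d)
    (α lam : ℝ) (hα : 1 / 2 < α) (hlam1 : 1 ≤ lam) (hlam2 : lam < 2 * α)
    (γ : Fin d → ℝ) (hγ : ∀ j, 0 < γ j) (s : Fin d) (z : Fin d → ℤ) :
    (1 / (n : ℝ)) *
        ∑ zs ∈ Finset.range n,
          (theta n d α γ s (Function.update z s (zs : ℤ))) ^ (1 / lam)
      ≤ (2 / (n : ℝ)) *
        ∑ u ∈ Finset.univ.powerset.filter (fun u => s ∈ u),
          (∏ j ∈ u, γ j ^ (1 / lam)) * muAL α lam ^ u.card := by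
  have hl : 0 < lam := by linarith
  have hβ : 1 < 2 * α / lam := (one_lt_div hl).2 hlam2
  have hμ := muAL_nonneg hβ
  have hG : ∀ u : Finset (Fin d), 0 ≤ ∏ j ∈ u, γ j ^ (1 / lam) :=
    fun u => Finset.prod_nonneg fun j _ => Real.rpow_nonneg (hγ j).le _
  have key : ∑ zs ∈ Finset.range n,
      (theta n d α γ s (Function.update z s (zs : ℤ))) ^ (1 / lam) ≤
      2 * ∑ u ∈ Finset.univ.powerset.filter (fun u => s ∈ u),
        (∏ j ∈ u, γ j ^ (1 / lam)) * muAL α lam ^ u.card := by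
    have hR : ∀ u : Finset (Fin d), 0 ≤ (∏ j ∈ u, γ j ^ (1 / lam)) * muAL α lam ^ u.card :=
      fun u => mul_nonneg (hG u) (pow_nonneg hμ _)
    rw [← ENNReal.ofReal_le_ofReal_iff
        (mul_nonneg zero_le_two (Finset.sum_nonneg fun u _ => hR u)),
      ENNReal.ofReal_sum_of_nonneg fun _ _ => Real.rpow_nonneg (theta_nonneg n d α hγ s _) _]
    refine (Finset.sum_le_sum fun _ _ => ofReal_theta_rpow_le n d α hlam1 hγ s _).trans ?_
    rw [Finset.sum_comm, ENNReal.ofReal_mul zero_le_two, ENNReal.ofReal_sum_of_nonneg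
      fun u _ => hR u, Finset.mul_sum]
    refine Finset.sum_le_sum fun u hu => ?_
    rw [← Finset.mul_sum, ENNReal.ofReal_mul (hG u), ENNReal.ofReal_pow hμ,
      ← tsum_ofReal_abs_rpow hβ, mul_left_comm, ENNReal.ofReal_ofNat]
    gcongr
    exact sum_tsum_support_le hn (Finset.mem_filter.1 hu).2 z hβ
  calc _ ≤ (1 / (n : ℝ)) * (2 * ∑ u ∈ Finset.univ.powerset.filter (fun u => s ∈ u),
        (∏ j ∈ u, γ j ^ (1 / lam)) * muAL α lam ^ u.card) := by gcongr
    _ = _ := by ring
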